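/- arXiv:math/0207041 — 4 statements merged into one kernel-verified Lean document; each statement's English description precedes it below -/
import Mathlib

section
/- Let w ∈ B, with chain {1,…,d} = K_1 ⊋ … ⊋ K_r and cells S_j = K_j ∖ K_{j+1} as above. Then for every nonempty S ⊆ {1,…,d}, setting i = max{j : S ⊆ K_j}, one has: w^S_n = 0 for every n ∉ S ∩ S_i, and there exists a constant c > 0 such that w^S_n = c·C_n^{K_i∖S}·w^{K_i}_n for every n ∈ S ∩ S_i. -/
noncomputable section
open Polynomial Filter Topology ENNReal

/-- The inner product `⟨p,q⟩_v = ∑ₖ p(μₖ)q(μₖ)vₖ`. -/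
def ip {m : ℕ} (μ v : Fin m → ℝ) (p q : ℝ[X]) : ℝ :=
  ∑ k, p.eval (μ k) * q.eval (μ k) * v k

/-- Pair `(pₙ, pₙ₋₁)` of monic orthogonal polynomials (with `p₋₁ = 0`). -/
def opAux {m : ℕ} (μ v : Fin m → ℝ) : ℕ → ℝ[X] × ℝ[X]
  | 0 => (1, 0)
  | n + 1 =>
    let P := opAux μ v n
    ((X - C (ip μ v P.1 (X * P.1) / ip μ v P.1 P.1)) * P.1
        - C (ip μ v P.1 P.1 / ip μ v P.2 P.2) * P.2, P.1)

/-- The `n`-th monic orthogonal polynomial of the recursion. -/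
def op {m : ℕ} (μ v : Fin m → ℝ) (n : ℕ) : ℝ[X] := (opAux μ v n).1

/-- The entry `a_N` of the Jacobi matrix construction: for odd `N = 2n+1` the diagonal
entry `a_{2n+1} = ⟨pₙ, Xpₙ⟩/⟨pₙ,pₙ⟩`, for even `N = 2n` the off-diagonal entry
`a_{2n} = √(⟨pₙ,pₙ⟩/⟨pₙ₋₁,pₙ₋₁⟩)`. -/
def fEnt {m : ℕ} (μ v : Fin m → ℝ) (N : ℕ) : ℝ :=
  if N % 2 = 1 then
    ip μ v (op μ v (N / 2)) (X * op μ v (N / 2)) / ip μ v (op μ v (N / 2)) (op μ v (N / 2))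
  else
    Real.sqrt (ip μ v (op μ v (N / 2)) (op μ v (N / 2)) /
      ip μ v (op μ v (N / 2 - 1)) (op μ v (N / 2 - 1)))

/-- The symmetric tridiagonal matrix `f(μ, v)` with diagonal `a₁,a₃,…` and
sub/super-diagonal `a₂,a₄,…`. -/
def Jmat {m : ℕ} (μ v : Fin m → ℝ) : Matrix (Fin m) (Fin m) ℝ :=
  Matrix.of fun i j =>
    if i = j then fEnt μ v (2 * (i : ℕ) + 1)
    else if (i : ℕ) + 1 = (j : ℕ) ∨ (j : ℕ) + 1 = (i : ℕ) then fEnt μ v ((i : ℕ) + (j : ℕ) + 1)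
    else 0

/-- Restriction of `g : Fin d → ℝ` to a subset `Q`, reindexed in increasing order. -/
def restr {d : ℕ} (Q : Finset (Fin d)) (g : Fin d → ℝ) : Fin Q.card → ℝ :=
  fun k => g ((Q.orderIsoOfFin rfl) k).1

/-- Leading `i × i` principal submatrix. -/
def leadSub {d : ℕ} (J : Matrix (Fin d) (Fin d) ℝ) (i : ℕ) (h : i ≤ d) :
    Matrix (Fin i) (Fin i) ℝ :=
  Matrix.of fun a b => J ⟨a.1, lt_of_lt_of_le a.2 h⟩ ⟨b.1, lt_of_lt_of_le b.2 h⟩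

/-- A sequence of positive weight vectors is stable if all pairwise ratios converge
in `[0,∞]`. -/
def Stable {d : ℕ} (w : ℕ → Fin d → ℝ) : Prop :=
  (∀ n i, 0 < w n i) ∧
    ∀ i j : Fin d, ∃ L : ℝ≥0∞,
      Tendsto (fun n => ENNReal.ofReal (w n i / w n j)) atTop (𝓝 L)

/-- `S : Fin r → Finset (Fin d)` is an ordered partition of `{0,…,d-1}`. -/
def OrdPart {d r : ℕ} (S : Fin r → Finset (Fin d)) : Prop :=
  (∀ j, (S j).Nonempty) ∧ (∀ j k, j ≠ k → Disjoint (S j) (S k)) ∧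
    Finset.univ.biUnion S = (Finset.univ : Finset (Fin d))

/-- `S` is the limiting partition of the stable sequence `w`. -/
def LimPart {d r : ℕ} (w : ℕ → Fin d → ℝ) (S : Fin r → Finset (Fin d)) : Prop :=
  OrdPart S ∧
  (∀ i j : Fin d, (∃ a, i ∈ S a ∧ j ∈ S a) ↔
      ∃ L : ℝ, 0 < L ∧ Tendsto (fun n => w n i / w n j) atTop (𝓝 L)) ∧
  (∀ a b : Fin r, a < b → ∀ i ∈ S a, ∀ j ∈ S b,
      Tendsto (fun n => w n i / w n j) atTop atTop)

/-- The constant `C_i^T = ∏_{t ∈ T} (λ_t − λ_i)²`. -/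
def Cc {d : ℕ} (lam : Fin d → ℝ) (i : Fin d) (T : Finset (Fin d)) : ℝ :=
  ∏ t ∈ T, (lam t - lam i) ^ 2

/-- Offset `∑_{k<j} |S_k|` of the `j`-th block. -/
def offS {d r : ℕ} (S : Fin r → Finset (Fin d)) (j : Fin r) : ℕ :=
  ∑ k ∈ Finset.univ.filter (· < j), (S k).card

/-- The block-diagonal matrix whose `j`-th block (in rows/columns
`offS S j, …, offS S j + |S_j| - 1`) is `Jmat (restr (S j) lam) (restr (S j) (v j))`. -/
def blockDiag {d r : ℕ} (lam : Fin d → ℝ) (S : Fin r → Finset (Fin d))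
    (v : Fin r → Fin d → ℝ) : Matrix (Fin d) (Fin d) ℝ :=
  Matrix.of fun p q =>
    ∑ j : Fin r,
      if h : offS S j ≤ (p : ℕ) ∧ (p : ℕ) < offS S j + (S j).card ∧
          offS S j ≤ (q : ℕ) ∧ (q : ℕ) < offS S j + (S j).card then
        Jmat (restr (S j) lam) (restr (S j) (v j))
          ⟨(p : ℕ) - offS S j, by omega⟩ ⟨(q : ℕ) - offS S j, by omega⟩
      else 0

/-- Nonempty subsets of `Fin d`. -/
abbrev NES (d : ℕ) := {S : Finset (Fin d) // S.Nonempty}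

/-- The ambient Euclidean space of families `(w^S)` indexed by nonempty subsets. -/
abbrev Ew (d : ℕ) := NES d → Fin d → ℝ

/-- The blow-up `B` (normalized representatives): support, nonnegativity,
normalization, and the quadratic equations. -/
def Bset {d : ℕ} (lam : Fin d → ℝ) : Set (Ew d) :=
  {w | (∀ S : NES d, ∀ n, n ∉ S.1 → w S n = 0) ∧
    (∀ S n, 0 ≤ w S n) ∧
    (∀ S : NES d, ∑ n ∈ S.1, w S n = 1) ∧
    ∀ R S : NES d, R.1 ⊆ S.1 → ∀ i ∈ R.1, ∀ j ∈ R.1,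
      Cc lam i (S.1 \ R.1) * w R j * w S i = Cc lam j (S.1 \ R.1) * w R i * w S j}

/-- `𝒥̄^Λ`: symmetric tridiagonal matrices with nonnegative off-diagonal entries and
characteristic polynomial `∏ (X − λ_k)`. -/
def Jset {d : ℕ} (lam : Fin d → ℝ) : Set (Matrix (Fin d) (Fin d) ℝ) :=
  {J | (∀ i j, J i j = J j i) ∧
    (∀ i j : Fin d, (i : ℕ) + 2 ≤ (j : ℕ) ∨ (j : ℕ) + 2 ≤ (i : ℕ) → J i j = 0) ∧
    (∀ i j : Fin d, (i : ℕ) + 1 = (j : ℕ) → 0 ≤ J i j) ∧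
    J.charpoly = ∏ k, (X - C (lam k))}

/-- `K_j = S_j ∪ S_{j+1} ∪ … ∪ S_r`. -/
def Kof {d r : ℕ} (S : Fin r → Finset (Fin d)) (j : Fin r) : Finset (Fin d) :=
  (Finset.univ.filter (j ≤ ·)).biUnion S

/-- The piece `Z(P)` of `B` corresponding to the ordered partition `P = (S_1,…,S_r)`:
for every nonempty `T`, the support of `w^T` is `T ∩ S_{i(T,P)}`. -/
def Zset {d : ℕ} (lam : Fin d → ℝ) {r : ℕ} (S : Fin r → Finset (Fin d)) : Set (Ew d) :=
  {w | w ∈ Bset lam ∧ ∀ T : NES d, ∃ j : Fin r, T.1 ⊆ Kof S j ∧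
    (∀ k, T.1 ⊆ Kof S k → k ≤ j) ∧ ∀ n : Fin d, w T n ≠ 0 ↔ n ∈ T.1 ∧ n ∈ S j}

/-- `R ⪯ S`: the ordered partition `R` refines `S`, i.e. `R` is the concatenation of
ordered partitions of `S_1`, then `S_2`, etc. -/
def Refines {d q r : ℕ} (R : Fin q → Finset (Fin d)) (S : Fin r → Finset (Fin d)) : Prop :=
  ∃ b : Fin (r + 1) → ℕ, b 0 = 0 ∧ b (Fin.last r) = q ∧
    (∀ i j : Fin (r + 1), i ≤ j → b i ≤ b j) ∧
    ∀ i : Fin r, S i = (Finset.univ.filter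
      (fun k : Fin q => b i.castSucc ≤ (k : ℕ) ∧ (k : ℕ) < b i.succ)).biUnion R

/-- The `j`-th consecutive interval `I_j(T)` of lengths `|T_1|,…,|T_r|`. -/
def Iint {d r : ℕ} (T : Fin r → Finset (Fin d)) (j : Fin r) : Finset (Fin d) :=
  Finset.univ.filter (fun m : Fin d => offS T j ≤ (m : ℕ) ∧ (m : ℕ) < offS T j + (T j).card)

/-- `H(T) = {σ : σ(T_j) = I_j(T) for all j}`. -/
def Hset {d r : ℕ} (T : Fin r → Finset (Fin d)) : Set (Equiv.Perm (Fin d)) :=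
  {σ | ∀ j, (T j).image σ = Iint T j}

/-- Interval Young subgroups: setwise stabilizers of a division of `{0,…,d-1}` into
consecutive intervals. -/
def IsIntervalYoung {d : ℕ} (G : Set (Equiv.Perm (Fin d))) : Prop :=
  ∃ (q : ℕ) (c : Fin q → Finset (Fin d)), OrdPart c ∧ (∀ j : Fin q, c j = Iint c j) ∧
    G = {τ : Equiv.Perm (Fin d) | ∀ j, (c j).image ⇑τ = c j}

/-- Number of surjections from an `a`-element set onto a `b`-element set. -/
def Surj (a b : ℕ) : ℕ := Fintype.card {f : Fin a → Fin b // Function.Surjective f}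

/-- The Euler characteristic `χ_d = ∑_{q=1}^d (−2)^{d−q}·Surj(d,q)`. -/
def chi (a : ℕ) : ℝ := ∑ q ∈ Finset.Icc 1 a, (-2 : ℝ) ^ (a - q) * (Surj a q : ℝ)
theorem Cc_pos {d : ℕ} {lam : Fin d → ℝ} (hlam : Function.Injective lam) {n : Fin d}
    {T : Finset (Fin d)} (hn : n ∉ T) : 0 < Cc lam n T := by
  refine Finset.prod_pos fun t ht => ?_
  have hne : lam t ≠ lam n := fun h => hn (hlam h ▸ ht)
  exact sq_pos_of_ne_zero (sub_ne_zero.mpr hne)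

/-- If `w^S` does not vanish identically on `R ⊆ S`, then `w^R` is a positive multiple of
`C^{S∖R} · w^S` on `R`. -/
theorem Bset.exists_pos_proportional {d : ℕ} {lam : Fin d → ℝ} (hlam : Function.Injective lam)
    {w : Ew d} (hw : w ∈ Bset lam) {R S : NES d} (hRS : R.1 ⊆ S.1) {a : Fin d} (ha : a ∈ R.1)
    (hwa : w S a ≠ 0) :
    ∃ c : ℝ, 0 < c ∧ ∀ n ∈ R.1, w R n = c * Cc lam n (S.1 \ R.1) * w S n := by
  obtain ⟨-, hnonneg, hsum, hquad⟩ := hw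
  have hSa : 0 < w S a := (hnonneg S a).lt_of_ne' hwa
  have hC : 0 < Cc lam a (S.1 \ R.1) := Cc_pos hlam fun h => (Finset.mem_sdiff.mp h).2 ha
  have hprop : ∀ n ∈ R.1, w R n =
      w R a / (Cc lam a (S.1 \ R.1) * w S a) * Cc lam n (S.1 \ R.1) * w S n := by
    intro n hn
    have h := hquad R S hRS a ha n hn
    field_simp
    linarith
  have hRa : w R a ≠ 0 := by
    intro h0
    have hzero : ∑ n ∈ R.1, w R n = 0 :=
      Finset.sum_eq_zero fun n hn => by simpa [h0] using hprop n hn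
    exact zero_ne_one (hzero.symm.trans (hsum R))
  exact ⟨_, div_pos ((hnonneg R a).lt_of_ne' hRa) (mul_pos hC hSa), hprop⟩

/-- An element of a member of a finite sequence of sets lies in a last member containing it. -/
theorem exists_last_mem {d r : ℕ} (K : Fin r → Finset (Fin d)) {i : Fin r} {n : Fin d}
    (hn : n ∈ K i) :
    ∃ j, i ≤ j ∧ n ∈ K j ∧ ∀ h : (j : ℕ) + 1 < r, n ∉ K ⟨(j : ℕ) + 1, h⟩ := by
  obtain ⟨j, hij, hj⟩ := Finite.exists_le_maximal (p := fun j => n ∈ K j) hn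
  refine ⟨j, hij, hj.prop, fun h hmem => ?_⟩
  have hle : (j : ℕ) + 1 ≤ j := hj.le_of_ge hmem (Nat.le_succ (j : ℕ))
  omega

/-- for `w ∈ B`, each `w^S` is supported on `S ∩ S_i` and is there
proportional to `(C_n^{K_i∖S}·w^{K_i}_n)`. -/
theorem stmt11 {d r : ℕ} (hd : 1 ≤ d) (lam : Fin d → ℝ) (hlam : Function.Injective lam)
    (w : Ew d) (hw : w ∈ Bset lam) (hr : 1 ≤ r)
    (K : Fin r → Finset (Fin d)) (hK0 : K ⟨0, hr⟩ = Finset.univ)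
    (hchain : ∀ j k : Fin r, j < k → K k ⊂ K j)
    (hKne : ∀ j, (K j).Nonempty)
    (hphi : ∀ j : Fin r, ∀ n ∈ K j,
      (∀ h : (j : ℕ) + 1 < r, n ∉ K ⟨(j : ℕ) + 1, h⟩) →
      w ⟨K j, hKne j⟩ n ≠ 0 ∧ ∀ T : NES d, w T n ≠ 0 → T.1.card ≤ (K j).card) :
    ∀ (T : Finset (Fin d)) (hT : T.Nonempty) (i : Fin r), T ⊆ K i →
      (∀ j, T ⊆ K j → j ≤ i) →
      (∀ n : Fin d,
        ¬(n ∈ T ∧ n ∈ K i ∧ ∀ h : (i : ℕ) + 1 < r, n ∉ K ⟨(i : ℕ) + 1, h⟩) →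
        w ⟨T, hT⟩ n = 0) ∧
      ∃ c : ℝ, 0 < c ∧ ∀ n ∈ T, n ∈ K i →
        (∀ h : (i : ℕ) + 1 < r, n ∉ K ⟨(i : ℕ) + 1, h⟩) →
        w ⟨T, hT⟩ n = c * Cc lam n (K i \ T) * w ⟨K i, hKne i⟩ n := by
  intro T hT i hTi hmax
  obtain ⟨a, haT, ha⟩ : ∃ a ∈ T, ∀ h : (i : ℕ) + 1 < r, a ∉ K ⟨(i : ℕ) + 1, h⟩ := by
    by_cases h : (i : ℕ) + 1 < r
    · obtain ⟨a, haT, ha⟩ := Finset.not_subset.mp fun hsub : T ⊆ K ⟨(i : ℕ) + 1, h⟩ =>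
        Nat.not_succ_le_self (i : ℕ) (hmax _ hsub)
      exact ⟨a, haT, fun _ => ha⟩
    · obtain ⟨a, haT⟩ := hT
      exact ⟨a, haT, fun h' => absurd h' h⟩
  obtain ⟨c, hc, hprop⟩ := Bset.exists_pos_proportional hlam hw (R := ⟨T, hT⟩)
    (S := ⟨K i, hKne i⟩) hTi haT (hphi i a (hTi haT) ha).1
  refine ⟨fun n hn => ?_, c, hc, fun n hnT _ _ => hprop n hnT⟩
  by_cases hnT : n ∈ T
  · obtain ⟨j, hij, hnj, hlast⟩ := exists_last_mem K (hTi hnT)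
    have hlt : i < j := hij.lt_of_ne fun h => hn ⟨hnT, hTi hnT, h ▸ hlast⟩
    have hzero : w ⟨K i, hKne i⟩ n = 0 := by
      by_contra h
      exact ((hphi j n hnj hlast).2 _ h).not_gt (Finset.card_lt_card (hchain i j hlt))
    rw [hprop n hnT, hzero, mul_zero]
  · exact hw.1 _ n hnT
end
end

section
/- For every real number x with |x| < π/2, the series Σ_{d=1}^∞ χ_d·x^d/d! converges and its sum is tanh x; that is, tanh x = Σ_{d≥1} χ_d·x^d/d!. -/
noncomputable section
open Polynomial Filter Topology ENNReal

theorem Complex.cosh_ne_zero_of_norm_lt {z : ℂ} (hz : ‖z‖ < Real.pi / 2) : Complex.cosh z ≠ 0 := by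
  rw [← Complex.cos_mul_I, Complex.cos_ne_zero_iff]
  intro k hk
  have hnorm : ‖z‖ = |(2 * k + 1 : ℝ)| * Real.pi / 2 := by
    have h := congrArg (‖·‖) hk
    have hc : ((2 * k + 1) * Real.pi / 2 : ℂ) = (((2 * k + 1) * Real.pi / 2 : ℝ) : ℂ) := by
      push_cast; ring
    simp only [hc, norm_mul, Complex.norm_I, mul_one, Complex.norm_real, Real.norm_eq_abs] at h
    rw [h, abs_div, abs_mul, abs_of_pos Real.pi_pos, abs_two]
  have hk1 : (1 : ℝ) ≤ |(2 * k + 1 : ℝ)| := by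
    have : (1 : ℤ) ≤ |2 * k + 1| := Int.one_le_abs (by omega)
    exact_mod_cast this
  nlinarith [Real.pi_pos]

theorem Complex.hasDerivAt_tanh {z : ℂ} (hz : Complex.cosh z ≠ 0) :
    HasDerivAt Complex.tanh (1 - Complex.tanh z ^ 2) z := by
  have h := (Complex.hasDerivAt_sinh z).div (Complex.hasDerivAt_cosh z) hz
  have hf : Complex.tanh = Complex.sinh / Complex.cosh :=
    funext Complex.tanh_eq_sinh_div_cosh
  rw [hf]
  convert! h using 1
  rw [Pi.div_apply]
  field_simp

theorem Surj_zero_zero : Surj 0 0 = 1 := by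
  simp [Surj, Function.Surjective]

theorem Surj_succ_zero (n : ℕ) : Surj (n + 1) 0 = 0 := by
  unfold Surj
  rw [Fintype.card_eq_zero_iff]
  exact ⟨fun f => (f.1 0).elim0⟩

theorem Surj_eq_zero_of_lt {n q : ℕ} (h : n < q) : Surj n q = 0 := by
  unfold Surj
  rw [Fintype.card_eq_zero_iff]
  refine ⟨fun f => ?_⟩
  have := Fintype.card_le_of_surjective f.1 f.2
  simp at this
  omega

/-- A surjection `Fin (n + 1) → Fin (q + 1)` is determined by its value `a` at `0` and its tail,
which is either surjective or has image the complement of `a`. -/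
theorem Surj_succ_succ (n q : ℕ) :
    Surj (n + 1) (q + 1) = (q + 1) * (Surj n (q + 1) + Surj n q) := by
  let Φ : Fin (q + 1) × ({f : Fin n → Fin (q + 1) // Function.Surjective f} ⊕
      {f : Fin n → Fin q // Function.Surjective f}) →
      {f : Fin (n + 1) → Fin (q + 1) // Function.Surjective f} := fun p =>
    match p with
    | (a, .inl f) => ⟨Fin.cons a f.1, fun b => by
        obtain ⟨i, hi⟩ := f.2 b
        exact ⟨i.succ, by simpa using hi⟩⟩
    | (a, .inr g) => ⟨Fin.cons a (a.succAbove ∘ g.1), fun b => by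
        rcases Fin.eq_self_or_eq_succAbove a b with rfl | ⟨c, rfl⟩
        · exact ⟨0, by simp⟩
        · obtain ⟨i, rfl⟩ := g.2 c
          exact ⟨i.succ, by simp⟩⟩
  have hΦ : Function.Bijective Φ := by
    constructor
    · rintro ⟨a, f | f⟩ ⟨b, g | g⟩ hfg <;>
        obtain ⟨rfl, h⟩ := Fin.cons_injective2 (α := fun _ => Fin (q + 1))
          (congrArg Subtype.val hfg)
      · rw [Subtype.ext h]
      · obtain ⟨i, hi⟩ := f.2 a
        rw [h] at hi
        exact absurd hi (Fin.succAbove_ne _ _)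
      · obtain ⟨i, hi⟩ := g.2 a
        rw [← h] at hi
        exact absurd hi (Fin.succAbove_ne _ _)
      · rw [Subtype.ext (Fin.succAbove_right_injective.comp_left h)]
    · rintro ⟨f, hf⟩
      by_cases ht : Function.Surjective (Fin.tail f)
      · exact ⟨(f 0, .inl ⟨Fin.tail f, ht⟩), Subtype.ext (Fin.cons_self_tail f)⟩
      · have hsurj : ∀ b, b ≠ f 0 → ∃ i, Fin.tail f i = b := fun b hb => by
          obtain ⟨i, hi⟩ := hf b
          induction i using Fin.cases with
          | zero => exact absurd hi.symm hb
          | succ i => exact ⟨i, hi⟩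
        have hne : ∀ i, Fin.tail f i ≠ f 0 := fun i hi => ht fun b => by
          by_cases hb : b = f 0
          · exact ⟨i, hi.trans hb.symm⟩
          · exact hsurj b hb
        choose g hg using fun i => Fin.exists_succAbove_eq (hne i)
        refine ⟨(f 0, .inr ⟨g, fun c => ?_⟩), Subtype.ext ?_⟩
        · obtain ⟨i, hi⟩ := hsurj _ (Fin.succAbove_ne (f 0) c)
          exact ⟨i, Fin.succAbove_right_injective ((hg i).trans hi)⟩
        · refine Eq.trans ?_ (Fin.cons_self_tail f)
          exact congrArg (Fin.cons (α := fun _ => Fin (q + 1)) (f 0)) (funext hg)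
  have h := Fintype.card_of_bijective hΦ
  rw [Fintype.card_prod, Fintype.card_sum, Fintype.card_fin] at h
  exact h.symm

/-- The successive derivatives of `1 + tanh`, as a polynomial in `1 - tanh` times `1 + tanh`. -/
theorem iteratedDeriv_one_add_tanh (n : ℕ) {z : ℂ} (hz : Complex.cosh z ≠ 0) :
    iteratedDeriv n (fun w => 1 + Complex.tanh w) z =
      ∑ q ∈ Finset.range (n + 1), (-2 : ℂ) ^ (n - q) * (Surj n q : ℂ) *
        ((1 - Complex.tanh z) ^ q * (1 + Complex.tanh z)) := by
  induction n generalizing z with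
  | zero => simp [Surj_zero_zero]
  | succ n ih =>
    have hev : iteratedDeriv n (fun w => 1 + Complex.tanh w) =ᶠ[𝓝 z]
        fun z => ∑ q ∈ Finset.range (n + 1), (-2 : ℂ) ^ (n - q) * (Surj n q : ℂ) *
          ((1 - Complex.tanh z) ^ q * (1 + Complex.tanh z)) := by
      filter_upwards [Complex.continuous_cosh.continuousAt.eventually_ne hz] with w hw
      exact ih hw
    rw [iteratedDeriv_succ, hev.deriv_eq]
    set t := Complex.tanh z
    have ht := Complex.hasDerivAt_tanh hz
    have hterm (q : ℕ) : HasDerivAt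
        (fun z => (1 - Complex.tanh z) ^ q * (1 + Complex.tanh z))
        ((q + 1) * ((1 - t) ^ (q + 1) * (1 + t)) - 2 * q * ((1 - t) ^ q * (1 + t))) z := by
      convert! ((ht.const_sub 1).pow q).mul (ht.const_add 1) using 1
      rcases q with _ | q
      · simp [t]
        ring
      · simp only [Pi.pow_apply, Nat.add_sub_cancel, t]
        push_cast
        ring
    have hsum := HasDerivAt.fun_sum fun q (_ : q ∈ Finset.range (n + 1)) =>
      (hterm q).const_mul ((-2 : ℂ) ^ (n - q) * (Surj n q : ℂ))
    rw [hsum.deriv, Finset.sum_range_succ' _ (n + 1), Surj_succ_zero]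
    have hshift : ∑ q ∈ Finset.range (n + 1), (-2 : ℂ) ^ (n - q) * (Surj n q : ℂ) *
          (2 * q * ((1 - t) ^ q * (1 + t))) =
        -∑ q ∈ Finset.range (n + 1), (-2 : ℂ) ^ (n - q) * (q + 1) * (Surj n (q + 1) : ℂ) *
          ((1 - t) ^ (q + 1) * (1 + t)) := by
      rw [Finset.sum_range_succ', Finset.sum_range_succ _ n, Surj_eq_zero_of_lt n.lt_succ_self]
      simp only [Nat.cast_zero, mul_zero, zero_mul, add_zero]
      rw [← Finset.sum_neg_distrib]
      refine Finset.sum_congr rfl fun q hq => ?_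
      have hq := Finset.mem_range.1 hq
      rw [show n - q = (n - (q + 1)) + 1 by omega, pow_succ]
      push_cast
      ring
    simp only [mul_sub, Finset.sum_sub_distrib]
    rw [hshift, sub_neg_eq_add, ← Finset.sum_add_distrib]
    simp only [Nat.cast_zero, mul_zero, zero_mul, add_zero]
    refine Finset.sum_congr rfl fun q _ => ?_
    rw [Surj_succ_succ, Nat.add_sub_add_right]
    push_cast
    ring

theorem iteratedDeriv_one_add_tanh_zero (n : ℕ) :
    iteratedDeriv n (fun w => 1 + Complex.tanh w) 0 = (chi n : ℂ) + if n = 0 then 1 else 0 := by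
  rw [iteratedDeriv_one_add_tanh n (by simp)]
  rcases n with _ | n
  · simp [chi, Surj_zero_zero]
  · rw [Finset.sum_range_succ', Surj_succ_zero, chi,
      ← Finset.Ico_add_one_right_eq_Icc, Finset.sum_Ico_eq_sum_range]
    simp [add_comm]

/-- Theorem 36: `tanh` generates the Euler characteristics. -/
theorem stmt15 (x : ℝ) (hx : |x| < Real.pi / 2) :
    HasSum (fun a : ℕ => chi a * x ^ a / (a.factorial : ℝ)) (Real.tanh x) := by
  have hdiff : DifferentiableOn ℂ (fun w => 1 + Complex.tanh w)
      (Metric.ball 0 (Real.pi / 2)) := fun z hz =>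
    ((Complex.hasDerivAt_tanh (Complex.cosh_ne_zero_of_norm_lt (by simpa using hz))).const_add
      1).differentiableAt.differentiableWithinAt
  have hsum := Complex.hasSum_taylorSeries_on_ball hdiff (z := (x : ℂ)) (by simpa using hx)
  have hone : HasSum (fun n : ℕ => if n = 0 then (1 : ℂ) else 0) 1 := hasSum_ite_eq 0 1
  have h := hsum.sub hone
  rw [← Complex.hasSum_ofReal]
  convert! h using 1
  · funext n
    rw [iteratedDeriv_one_add_tanh_zero]
    rcases n with _ | n
    · simp
    · simp only [sub_zero, smul_eq_mul]
      push_cast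
      simp
      ring
  · simp
end
end

section
/- Let J be a d×d Jacobi matrix whose characteristic polynomial equals p, let n ∈ {1,…,d}, and let u ∈ ℝ^d be a unit vector satisfying J·u = λ_n·u. Then u_1² = det(λ_n·I − J^{11}) / p′(λ_n). -/
noncomputable section
open Polynomial Filter Topology ENNReal

/-- A vector in the kernel of `x - J`, with `J` a Jacobi matrix, vanishes as soon as its first
entry does. -/
theorem eq_zero_of_jacobi_mulVec_eq_smul {m : ℕ} {J : Matrix (Fin (m + 1)) (Fin (m + 1)) ℝ}
    (htri : ∀ i j : Fin (m + 1), (i : ℕ) + 2 ≤ (j : ℕ) ∨ (j : ℕ) + 2 ≤ (i : ℕ) → J i j = 0)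
    (hoff : ∀ i j : Fin (m + 1), (i : ℕ) + 1 = (j : ℕ) → 0 < J i j)
    {x : ℝ} {v : Fin (m + 1) → ℝ} (hv : J.mulVec v = x • v) (h0 : v 0 = 0) : v = 0 := by
  have key : ∀ (k : ℕ) (hk : k < m + 1), v ⟨k, hk⟩ = 0 := by
    intro k
    induction k using Nat.strong_induction_on with
    | _ k ih =>
      intro hk
      obtain _ | k := k
      · exact h0
      have hrow := congrFun hv ⟨k, by omega⟩
      rw [Matrix.mulVec, dotProduct, Finset.sum_eq_single (⟨k + 1, hk⟩ : Fin (m + 1)),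
        Pi.smul_apply, ih k (by omega), smul_zero] at hrow
      · exact (mul_eq_zero.mp hrow).resolve_left (hoff _ _ rfl).ne'
      · intro j _ hj
        have hj' : (j : ℕ) ≠ k + 1 := fun h => hj (Fin.ext h)
        rcases Nat.lt_or_ge j (k + 1) with h | h
        · rw [ih j h j.2, mul_zero]
        · rw [htri _ _ (Or.inl (by simp only; omega)), zero_mul]
      · simp
  exact funext fun i => key i i.2

/-- An eigenvector of `J` for `x` is an eigenvector of the adjugate of `x - J`, with eigenvalue the
derivative of the characteristic polynomial at `x`. -/
theorem adjugate_mulVec_eq_derivative_charpoly_smul {ι R : Type*} [Fintype ι] [DecidableEq ι]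
    [CommRing R] {J : Matrix ι ι R} {x : R} {u : ι → R} (hu : J.mulVec u = x • u) :
    (x • (1 : Matrix ι ι R) - J).adjugate.mulVec u = J.charpoly.derivative.eval x • u := by
  have hmap : (J.charmatrix).map (evalRingHom x) = x • (1 : Matrix ι ι R) - J := by
    ext i j
    by_cases h : i = j <;> simp [h]
  have hC : J.charmatrix.mulVec (C ∘ u) = (X - C x) • (C ∘ u) := by
    have h : (J.map C).mulVec (C ∘ u) = C x • (C ∘ u) := by
      ext1 i
      rw [← RingHom.map_mulVec, hu]
      simp
    rw [Matrix.charmatrix, Matrix.sub_mulVec, sub_smul]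
    congr 1
    ext1 i
    simp [Matrix.scalar_apply, Matrix.mulVec_diagonal]
  have hadj := congrArg (fun M => M.mulVec (C ∘ u)) (Matrix.adjugate_mul J.charmatrix)
  simp only [← Matrix.mulVec_mulVec, hC, Matrix.mulVec_smul, Matrix.smul_mulVec,
    Matrix.one_mulVec] at hadj
  ext i
  have h := congrArg (fun q => (derivative q).eval x) (congrFun hadj i)
  have hi := (evalRingHom x).map_mulVec J.charmatrix.adjugate (C ∘ u) i
  rw [← RingHom.mapMatrix_apply, RingHom.map_adjugate, RingHom.mapMatrix_apply, hmap] at hi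
  have hcomp : (evalRingHom x : R[X] → R) ∘ C ∘ u = u := by ext; simp
  rw [hcomp] at hi
  rw [← hi]
  simpa [derivative_mul, Matrix.charpoly] using h

/-- the normalized spectral weight formula
`u₁² = det(λ_n I − J^{11})/p′(λ_n)`. -/
theorem stmt16 {m : ℕ} (lam : Fin (m + 1) → ℝ) (hlam : Function.Injective lam)
    (J : Matrix (Fin (m + 1)) (Fin (m + 1)) ℝ)
    (hsym : ∀ i j, J i j = J j i)
    (htri : ∀ i j : Fin (m + 1), (i : ℕ) + 2 ≤ (j : ℕ) ∨ (j : ℕ) + 2 ≤ (i : ℕ) → J i j = 0)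
    (hoff : ∀ i j : Fin (m + 1), (i : ℕ) + 1 = (j : ℕ) → 0 < J i j)
    (hchar : J.charpoly = ∏ k, (X - C (lam k)))
    (n : Fin (m + 1)) (u : Fin (m + 1) → ℝ)
    (hunit : ∑ i, u i ^ 2 = 1)
    (heig : J.mulVec u = lam n • u) :
    u 0 ^ 2 =
      (lam n • (1 : Matrix (Fin m) (Fin m) ℝ) - J.submatrix Fin.succ Fin.succ).det /
        (Polynomial.derivative (∏ k, (X - C (lam k)))).eval (lam n) := by
  set p : ℝ[X] := ∏ k, (X - C (lam k)) with hp
  set A := lam n • (1 : Matrix (Fin (m + 1)) (Fin (m + 1)) ℝ) - J with hA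
  have hder : p.derivative.eval (lam n) ≠ 0 := by
    have hsep : p.Separable := separable_prod_X_sub_C_iff.mpr hlam
    refine hsep.eval₂_derivative_ne_zero (RingHom.id ℝ) ?_
    simp [hp, eval₂_id, eval_prod, Finset.prod_eq_zero_iff, sub_eq_zero]
  have hu0 : u 0 ≠ 0 := by
    intro h
    simp [eq_zero_of_jacobi_mulVec_eq_smul htri hoff heig h] at hunit
  have hAsymm : A.transpose = A := by
    have hJ : J.transpose = J := Matrix.ext fun i j => hsym j i
    simp [hA, hJ]
  have hdet : A.det = 0 := by
    refine Matrix.exists_mulVec_eq_zero_iff.mp ⟨u, fun h => hu0 (congrFun h 0), ?_⟩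
    rw [hA, Matrix.sub_mulVec, heig, Matrix.smul_mulVec, Matrix.one_mulVec, sub_self]
  -- The first column of the adjugate lies in the kernel of `A`, so it is a multiple of `u`.
  set w : Fin (m + 1) → ℝ := fun i => A.adjugate i 0 with hw
  have hJw : J.mulVec w = lam n • w := by
    have h : A.mulVec w = 0 := by
      ext i
      have := congrFun (congrFun (Matrix.mul_adjugate A) i) 0
      rwa [hdet, zero_smul] at this
    rw [hA, Matrix.sub_mulVec, Matrix.smul_mulVec, Matrix.one_mulVec, sub_eq_zero] at h
    exact h.symm
  have hprop : u 0 • w - w 0 • u = 0 := by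
    refine eq_zero_of_jacobi_mulVec_eq_smul htri hoff (x := lam n) ?_ ?_
    · rw [Matrix.mulVec_sub, Matrix.mulVec_smul, Matrix.mulVec_smul, hJw, heig, smul_sub,
        smul_comm, smul_comm (w 0)]
    · simp [mul_comm]
  have hdot : ∑ i, w i * u i = p.derivative.eval (lam n) * u 0 := by
    have h := congrFun (adjugate_mulVec_eq_derivative_charpoly_smul heig) 0
    rw [hchar, ← hA] at h
    have hadj : ∀ i, A.adjugate 0 i = w i := fun i => by
      rw [← Matrix.transpose_apply A.adjugate, Matrix.adjugate_transpose, hAsymm]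
    simpa [Matrix.mulVec, dotProduct, hadj] using h
  have hw0 : w 0 =
      (lam n • (1 : Matrix (Fin m) (Fin m) ℝ) - J.submatrix Fin.succ Fin.succ).det := by
    rw [hw]
    simp only [Matrix.adjugate_fin_succ_eq_det_submatrix]
    have hsub : A.submatrix Fin.succ Fin.succ =
        lam n • (1 : Matrix (Fin m) (Fin m) ℝ) - J.submatrix Fin.succ Fin.succ := by
      ext i j
      simp [hA, Matrix.one_apply]
    simp [← hsub, Fin.succAbove_zero]
  rw [← hw0, eq_div_iff hder]
  have hsum : u 0 * ∑ i, w i * u i = w 0 * ∑ i, u i ^ 2 := by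
    rw [Finset.mul_sum, Finset.mul_sum]
    refine Finset.sum_congr rfl fun i _ => ?_
    have h : u 0 * w i - w 0 * u i = 0 := congrFun hprop i
    linear_combination u i * h
  rw [hdot, hunit] at hsum
  linear_combination hsum
end
end

section
/- Let (S_1,…,S_r) be an ordered partition of {1,…,d}, and for each j let v^{(j)} ∈ ℝ^d satisfy v^{(j)}_i > 0 for i ∈ S_j. Write Q_j = S_1 ∪ … ∪ S_{j−1} (so Q_1 = ∅). For t ∈ (0,1) define w(t) ∈ (0,∞)^d by w(t)_i = t^{j−1}·v^{(j)}_i / C_i^{Q_j} for i ∈ S_j. Then, as t → 0⁺, the matrices f(λ, w(t)) converge entrywise to the block-diagonal d×d matrix whose j-th diagonal block (of size |S_j|, occupying rows and columns Σ_{k<j}|S_k|+1, …, Σ_{k≤j}|S_k|) is f(λ|_{S_j}, v^{(j)}|_{S_j}). -/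
noncomputable section
open Polynomial Filter Topology ENNReal

section InnerProduct

variable {m : ℕ} (μ v : Fin m → ℝ)

lemma ip_comm (p q : ℝ[X]) : ip μ v p q = ip μ v q p := by
  simp only [ip, mul_comm (p.eval _)]

lemma ip_add_left (p q g : ℝ[X]) : ip μ v (p + q) g = ip μ v p g + ip μ v q g := by
  simp only [ip, eval_add, add_mul, Finset.sum_add_distrib]

lemma ip_sub_left (p q g : ℝ[X]) : ip μ v (p - q) g = ip μ v p g - ip μ v q g := by
  simp only [ip, eval_sub, sub_mul, Finset.sum_sub_distrib]

lemma ip_sub_right (g p q : ℝ[X]) : ip μ v g (p - q) = ip μ v g p - ip μ v g q := by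
  simp only [ip_comm μ v g, ip_sub_left]

lemma ip_C_mul_left (a : ℝ) (p g : ℝ[X]) : ip μ v (C a * p) g = a * ip μ v p g := by
  simp only [ip, eval_mul, eval_C, Finset.mul_sum, mul_assoc]

lemma ip_C_mul_right (a : ℝ) (g p : ℝ[X]) : ip μ v g (C a * p) = a * ip μ v g p := by
  simp only [ip_comm μ v g, ip_C_mul_left]

lemma ip_X_mul_right (p g : ℝ[X]) : ip μ v p (X * g) = ip μ v (X * p) g := by
  simp only [ip, eval_mul, eval_X]
  exact Finset.sum_congr rfl fun _ _ => by ring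

end InnerProduct

section OrthogonalPolynomials

variable {m : ℕ} {μ v : Fin m → ℝ}

lemma op_one : op μ v 1 = X - C (ip μ v 1 (X * 1) / ip μ v 1 1) := by
  simp [op, opAux]

lemma op_add_two (n : ℕ) : op μ v (n + 2) =
    (X - C (ip μ v (op μ v (n + 1)) (X * op μ v (n + 1)) /
      ip μ v (op μ v (n + 1)) (op μ v (n + 1)))) * op μ v (n + 1)
    - C (ip μ v (op μ v (n + 1)) (op μ v (n + 1)) / ip μ v (op μ v n) (op μ v n)) * op μ v n :=
  rfl

lemma op_monic_natDegree (n : ℕ) : (op μ v n).Monic ∧ (op μ v n).natDegree = n := by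
  induction n using Nat.twoStepInduction with
  | zero => simp [op, opAux]
  | one => rw [op_one]; exact ⟨monic_X_sub_C _, natDegree_X_sub_C _⟩
  | more n ih₀ ih₁ =>
    rw [op_add_two]
    set a := ip μ v (op μ v (n + 1)) (X * op μ v (n + 1)) /
      ip μ v (op μ v (n + 1)) (op μ v (n + 1))
    set b := ip μ v (op μ v (n + 1)) (op μ v (n + 1)) / ip μ v (op μ v n) (op μ v n)
    have hM : ((X - C a) * op μ v (n + 1)).Monic := (monic_X_sub_C a).mul ih₁.1
    have hd : ((X - C a) * op μ v (n + 1)).natDegree = n + 2 := by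
      rw [(monic_X_sub_C a).natDegree_mul ih₁.1, natDegree_X_sub_C, ih₁.2]; omega
    have hlt : (C b * op μ v n).natDegree < ((X - C a) * op μ v (n + 1)).natDegree := by
      have := natDegree_C_mul_le b (op μ v n)
      rw [ih₀.2] at this
      omega
    refine ⟨hM.sub_of_left (degree_lt_degree hlt), ?_⟩
    rw [natDegree_sub_eq_left_of_natDegree_lt hlt, hd]

lemma op_monic (n : ℕ) : (op μ v n).Monic := (op_monic_natDegree n).1

lemma op_natDegree (n : ℕ) : (op μ v n).natDegree = n := (op_monic_natDegree n).2

lemma op_degree (n : ℕ) : (op μ v n).degree = n := by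
  rw [degree_eq_natDegree (op_monic n).ne_zero, op_natDegree]

lemma ip_op_self_pos (hμ : Function.Injective μ) (hv : ∀ i, 0 < v i) {n : ℕ} (hn : n < m) :
    0 < ip μ v (op μ v n) (op μ v n) := by
  have hnn : ∀ i ∈ Finset.univ, 0 ≤ (op μ v n).eval (μ i) * (op μ v n).eval (μ i) * v i :=
    fun i _ => mul_nonneg (mul_self_nonneg _) (hv i).le
  refine lt_of_le_of_ne (Finset.sum_nonneg hnn) fun h => (op_monic (μ := μ) (v := v) n).ne_zero ?_
  refine eq_zero_of_natDegree_lt_card_of_eval_eq_zero _ hμ (fun i => ?_) ?_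
  · have := (Finset.sum_eq_zero_iff_of_nonneg hnn).1 h.symm i (Finset.mem_univ i)
    simpa [(hv i).ne'] using this
  · simpa [op_natDegree] using hn

lemma degree_sub_C_coeff_mul_lt {g p : ℝ[X]} {n : ℕ} (hp : p.Monic) (hpn : p.natDegree = n)
    (hg : g.degree < (n + 1 : ℕ)) : (g - C (g.coeff n) * p).degree < n := by
  rw [degree_lt_iff_coeff_zero] at hg ⊢
  intro k hk
  rcases hk.eq_or_lt with rfl | hk
  · have : p.coeff n = 1 := by rw [← hpn]; exact hp.coeff_natDegree
    simp [this]
  · have : p.coeff k = 0 := coeff_eq_zero_of_natDegree_lt (by omega)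
    simp [this, hg k hk]

/-- Pairing with a polynomial orthogonal to all lower degrees only sees the top coefficient. -/
lemma ip_eq_coeff_mul {p : ℝ[X]} {n : ℕ} (hp : p.Monic) (hpn : p.natDegree = n)
    (horth : ∀ g : ℝ[X], g.degree < n → ip μ v g p = 0) {g : ℝ[X]}
    (hg : g.degree < (n + 1 : ℕ)) : ip μ v g p = g.coeff n * ip μ v p p := by
  have h := horth _ (degree_sub_C_coeff_mul_lt hp hpn hg)
  rw [ip_sub_left, ip_C_mul_left] at h
  linarith

lemma ip_op_eq_zero (hμ : Function.Injective μ) (hv : ∀ i, 0 < v i) (n : ℕ) (hn : n ≤ m)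
    (g : ℝ[X]) (hg : g.degree < n) : ip μ v g (op μ v n) = 0 := by
  induction n using Nat.twoStepInduction generalizing g with
  | zero =>
    have : g = 0 := by simpa using hg
    simp [this, ip]
  | one =>
    have hpos : 0 < ip μ v 1 1 := ip_op_self_pos (n := 0) hμ hv (by omega)
    obtain ⟨a, rfl⟩ : ∃ a, g = C a :=
      ⟨_, eq_C_of_degree_le_zero (Nat.WithBot.lt_one_iff_le_zero.1 (by simpa using hg))⟩
    rw [op_one, ← mul_one (C a), ip_C_mul_left, ip_sub_right, ← mul_one (C (_ / _)),
      ip_C_mul_right, mul_one X, div_mul_cancel₀ _ hpos.ne', sub_self, mul_zero]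
  | more n ih₀ ih₁ =>
    have orth₀ := ih₀ (by omega)
    have orth₁ := ih₁ (by omega)
    have hp₀ := ip_op_self_pos (n := n) hμ hv (by omega)
    have hp₁ := ip_op_self_pos (n := n + 1) hμ hv (by omega)
    have key : ∀ f : ℝ[X], ip μ v f (op μ v (n + 2)) = ip μ v (X * f) (op μ v (n + 1))
        - ip μ v (op μ v (n + 1)) (X * op μ v (n + 1)) /
          ip μ v (op μ v (n + 1)) (op μ v (n + 1)) * ip μ v f (op μ v (n + 1))
        - ip μ v (op μ v (n + 1)) (op μ v (n + 1)) / ip μ v (op μ v n) (op μ v n)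
          * ip μ v f (op μ v n) := fun f => by
      rw [op_add_two, ip_sub_right, sub_mul, ip_sub_right, ip_C_mul_right, ip_C_mul_right,
        ip_X_mul_right]
    have hf := degree_sub_C_coeff_mul_lt (op_monic (n + 1)) (op_natDegree (μ := μ) (v := v) (n + 1))
      hg
    set f : ℝ[X] := g - C (g.coeff (n + 1)) * op μ v (n + 1) with hfdef
    have hgf : g = C (g.coeff (n + 1)) * op μ v (n + 1) + f := by rw [hfdef]; ring
    have hXf : (X * f).degree < ((n + 1 + 1 : ℕ) : WithBot ℕ) := by
      rw [degree_lt_iff_coeff_zero] at hf ⊢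
      intro k hk
      obtain ⟨k, rfl⟩ := Nat.exists_eq_add_of_le' (show 1 ≤ k by omega)
      rw [coeff_X_mul]
      exact hf k (by omega)
    have h₁ : ip μ v (op μ v (n + 1)) (op μ v (n + 2)) = 0 := by
      have h₀ : ip μ v (op μ v (n + 1)) (op μ v n) = 0 := by
        rw [ip_comm]
        exact orth₁ _ (by rw [op_degree]; exact_mod_cast n.lt_succ_self)
      rw [key, h₀, ← ip_X_mul_right, div_mul_cancel₀ _ hp₁.ne']
      ring
    have h₂ : ip μ v f (op μ v (n + 2)) = 0 := by
      rw [key, orth₁ f hf, ip_eq_coeff_mul (op_monic _) (op_natDegree _) orth₁ hXf,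
        ip_eq_coeff_mul (op_monic _) (op_natDegree _) orth₀ hf, coeff_X_mul]
      field_simp
      ring
    rw [hgf, ip_add_left, ip_C_mul_left, h₁, h₂]
    ring

end OrthogonalPolynomials

lemma sum_restr {d : ℕ} (T : Finset (Fin d)) (F : Fin d → ℝ) :
    ∑ k : Fin T.card, F ((T.orderIsoOfFin rfl) k).1 = ∑ i ∈ T, F i := by
  rw [← Finset.sum_coe_sort T F]
  exact (T.orderIsoOfFin rfl).toEquiv.sum_comp (fun i : T => F i.1)

lemma ip_restr {d : ℕ} (T : Finset (Fin d)) (lam u : Fin d → ℝ) (p q : ℝ[X]) :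
    ip (restr T lam) (restr T u) p q =
      ∑ i ∈ T, p.eval (lam i) * q.eval (lam i) * u i :=
  sum_restr T fun i => p.eval (lam i) * q.eval (lam i) * u i

lemma restr_injective {d : ℕ} (T : Finset (Fin d)) {lam : Fin d → ℝ}
    (hlam : Function.Injective lam) : Function.Injective (restr T lam) := fun _ _ h =>
  (T.orderIsoOfFin rfl).injective (Subtype.ext (hlam h))

lemma restr_pos {d : ℕ} (T : Finset (Fin d)) {u : Fin d → ℝ} (hu : ∀ i ∈ T, 0 < u i)
    (k : Fin T.card) : 0 < restr T u k :=
  hu _ ((T.orderIsoOfFin rfl) k).2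

lemma sum_eq_sum_lt_add_sum_eq_add_sum_gt {ι : Type*} [Fintype ι] (κ : ι → ℕ) (J : ℕ)
    (F : ι → ℝ) : ∑ i, F i = ∑ i with κ i < J, F i + ∑ i with κ i = J, F i +
      ∑ i with J < κ i, F i := by
  simp only [Finset.sum_filter, ← Finset.sum_add_distrib]
  refine Finset.sum_congr rfl fun i _ => ?_
  rcases lt_trichotomy (κ i) J with h | h | h
  · simp [h, h.ne, h.not_gt]
  · simp [h]
  · simp [h, h.ne', h.not_gt]

section MomentCurve

variable {d : ℕ} (lam : Fin d → ℝ) (κ : Fin d → ℕ) (c u : Fin d → ℝ) (J : ℕ)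

/-- Weights whose `i`-th entry is of order `t ^ κ i`. -/
def curveWeight (t : ℝ) (i : Fin d) : ℝ := t ^ κ i * c i

/-- The monic polynomial with simple roots at the nodes of order lower than `J`. -/
def lowPoly : ℝ[X] := ∏ i with κ i < J, (X - C (lam i))

/-- The `n`-th orthogonal polynomial attached to the nodes of order exactly `J`. -/
def blockOp (n : ℕ) : ℝ[X] :=
  op (restr {i | κ i = J} lam) (restr {i | κ i = J} u) n

lemma lowPoly_monic : (lowPoly lam κ J).Monic := monic_prod_of_monic _ _ fun _ _ => monic_X_sub_C _

lemma lowPoly_natDegree :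
    (lowPoly lam κ J).natDegree = (Finset.univ.filter fun i => κ i < J).card := by
  rw [lowPoly, natDegree_prod_of_monic _ _ fun _ _ => monic_X_sub_C _]
  simp

lemma lowPoly_eval_eq_zero {i : Fin d} (hi : κ i < J) : (lowPoly lam κ J).eval (lam i) = 0 := by
  rw [lowPoly, eval_prod]
  exact Finset.prod_eq_zero (Finset.mem_filter.2 ⟨Finset.mem_univ i, hi⟩) (by simp)

lemma lowPoly_eval_sq (i : Fin d) : (lowPoly lam κ J).eval (lam i) ^ 2 =
    Cc lam i {k | κ k < J} := by
  rw [lowPoly, eval_prod, ← Finset.prod_pow, Cc]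
  exact Finset.prod_congr rfl fun k _ => by simp; ring

variable {lam κ c u J} {n : ℕ}

lemma degree_divByMonic_lt {g W : ℝ[X]} (hW : W.Monic)
    (hg : g.degree < (W.natDegree + n : ℕ)) : (g /ₘ W).degree < n := by
  by_cases h : W.degree ≤ g.degree
  · have := degree_add_divByMonic hW h
    have hs : g /ₘ W ≠ 0 := fun h0 => by
      rw [divByMonic_eq_zero_iff hW] at h0
      exact absurd h0 h.not_gt
    rw [← this, degree_eq_natDegree hW.ne_zero, degree_eq_natDegree hs] at hg
    rw [degree_eq_natDegree hs]
    norm_cast at hg ⊢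
    omega
  · rw [(divByMonic_eq_zero_iff hW).2 (not_le.1 h), degree_zero]
    exact WithBot.bot_lt_coe n

/-- The functional `g ↦ ⟨g, lowPoly * blockOp⟩` on polynomials of lower degree is supported off
the nodes of order `J`, with coefficients that are small compared to the weights. -/
lemma exists_ip_lowPoly_mul_blockOp (hlam : Function.Injective lam)
    (hu : ∀ i, κ i = J → u i = c i * (lowPoly lam κ J).eval (lam i) ^ 2)
    (hu₀ : ∀ i, κ i = J → 0 < u i)
    (hn : n < (Finset.univ.filter fun i => κ i = J).card) :
    ∃ e : Fin d → ℝ, (∀ i, κ i = J → e i = 0) ∧ ∀ (t : ℝ) (g : ℝ[X]),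
      g.degree < ((Finset.univ.filter fun i => κ i < J).card + n : ℕ) →
      ip lam (curveWeight κ c t) g (lowPoly lam κ J * blockOp lam κ u J n) =
        ∑ i, e i * t ^ max J (κ i) * g.eval (lam i) := by
  set L : Finset (Fin d) := {i | κ i < J}
  set W := lowPoly lam κ J
  set q := blockOp lam κ u J n
  refine ⟨fun i => if κ i < J then ∑ k with κ k = J,
      (Lagrange.basis L lam i).eval (lam k) * q.eval (lam k) * c k * W.eval (lam k)
    else if J < κ i then (W * q).eval (lam i) * c i else 0, fun i hi => by simp [hi],
    fun t g hg => ?_⟩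
  have hW : W.Monic := lowPoly_monic lam κ J
  have hWL : W.natDegree = L.card := lowPoly_natDegree lam κ J
  have hr : ∀ x, (g %ₘ W).eval x = ∑ i ∈ L, g.eval (lam i) * (Lagrange.basis L lam i).eval x := by
    intro x
    have : g %ₘ W = Lagrange.interpolate L lam fun i => g.eval (lam i) := by
      refine Lagrange.eq_interpolate_of_eval_eq _ hlam.injOn ?_ fun i hi => ?_
      · rw [← hWL, ← degree_eq_natDegree hW.ne_zero]
        exact degree_modByMonic_lt g hW
      · rw [modByMonic_eq_sub_mul_div, eval_sub, eval_mul,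
          lowPoly_eval_eq_zero lam κ J (Finset.mem_filter.1 hi).2, zero_mul, sub_zero]
    rw [this, Lagrange.interpolate_apply, eval_finsetSum]
    simp
  have hs : ∑ k with κ k = J, (g /ₘ W).eval (lam k) * q.eval (lam k) * u k = 0 := by
    rw [← ip_restr]
    exact ip_op_eq_zero (restr_injective _ hlam) (restr_pos _ fun i hi => hu₀ i (by simpa using hi))
      n hn.le _ (degree_divByMonic_lt hW (by rwa [hWL]))
  have hblock : ∑ k with κ k = J, g.eval (lam k) * (W * q).eval (lam k) * c k =
      ∑ i ∈ L, (∑ k with κ k = J, (Lagrange.basis L lam i).eval (lam k) * q.eval (lam k) * c k *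
        W.eval (lam k)) * g.eval (lam i) := by
    calc _ = ∑ k with κ k = J, ((g %ₘ W).eval (lam k) * (q.eval (lam k) * c k * W.eval (lam k)) +
          (g /ₘ W).eval (lam k) * q.eval (lam k) * u k) := by
          refine Finset.sum_congr rfl fun k hk => ?_
          conv_lhs => rw [← modByMonic_add_div g W]
          rw [hu k (Finset.mem_filter.1 hk).2, eval_add, eval_mul, eval_mul]
          ring
      _ = _ := by
          rw [Finset.sum_add_distrib, hs, add_zero]
          simp only [hr, Finset.sum_mul]
          rw [Finset.sum_comm]
          exact Finset.sum_congr rfl fun i _ => Finset.sum_congr rfl fun k _ => by ring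
  rw [ip, sum_eq_sum_lt_add_sum_eq_add_sum_gt κ J,
    sum_eq_sum_lt_add_sum_eq_add_sum_gt κ J (fun i => _ * t ^ max J (κ i) * g.eval (lam i))]
  congr 1
  · have h₁ : ∑ i with κ i < J, g.eval (lam i) * (W * q).eval (lam i) * curveWeight κ c t i = 0 :=
      Finset.sum_eq_zero fun i hi => by
        rw [eval_mul, lowPoly_eval_eq_zero lam κ J (Finset.mem_filter.1 hi).2]; ring
    have h₂ : ∑ i with κ i = J, g.eval (lam i) * (W * q).eval (lam i) * curveWeight κ c t i =
        t ^ J * ∑ i with κ i = J, g.eval (lam i) * (W * q).eval (lam i) * c i := by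
      rw [Finset.mul_sum]
      refine Finset.sum_congr rfl fun i hi => ?_
      rw [curveWeight, (Finset.mem_filter.1 hi).2]; ring
    rw [h₁, h₂, hblock, zero_add, Finset.mul_sum]
    rw [Finset.sum_eq_zero (s := {i | κ i = J}), add_zero]
    · refine Finset.sum_congr rfl fun i hi => ?_
      have hi' := (Finset.mem_filter.1 hi).2
      rw [if_pos hi', max_eq_left hi'.le]
      ring
    · intro i hi
      simp [(Finset.mem_filter.1 hi).2]
  · refine Finset.sum_congr rfl fun i hi => ?_
    have hi' := (Finset.mem_filter.1 hi).2
    rw [if_neg hi'.not_gt, if_pos hi', max_eq_right hi'.le, curveWeight]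
    ring

lemma tendsto_mul_sub_sq {α : Type*} {l : Filter α} {a P g : α → ℝ} {L : ℝ}
    (hP : Tendsto (fun x => a x * P x ^ 2) l (𝓝 L))
    (hg : Tendsto (fun x => a x * g x ^ 2) l (𝓝 0)) :
    Tendsto (fun x => a x * (P x - g x) ^ 2) l (𝓝 L) := by
  have hPg : Tendsto (fun x => a x * P x * g x) l (𝓝 0) := by
    have h := ((hP.mul hg).congr fun x => show _ = (a x * P x * g x) ^ 2 by ring).sqrt
    simp only [Real.sqrt_sq_eq_abs, mul_zero, Real.sqrt_zero] at h
    exact (tendsto_zero_iff_abs_tendsto_zero _).2 h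
  have := (hP.sub (hPg.const_mul 2)).add hg
  simp only [mul_zero, sub_zero, add_zero] at this
  exact this.congr fun x => by ring

lemma tendsto_pow_nhdsWithin_zero {k : ℕ} (hk : k ≠ 0) :
    Tendsto (fun t : ℝ => t ^ k) (𝓝[Set.Ioo (0 : ℝ) 1] 0) (𝓝 0) := by
  have := ((continuous_pow k).tendsto (0 : ℝ)).mono_left
    (nhdsWithin_le_nhds (s := Set.Ioo (0 : ℝ) 1))
  simpa [hk] using this

lemma tendsto_curveWeight_mul_op_sq (hlam : Function.Injective lam) (hc : ∀ i, 0 < c i)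
    (hu : ∀ i, κ i = J → u i = c i * (lowPoly lam κ J).eval (lam i) ^ 2)
    (hu₀ : ∀ i, κ i = J → 0 < u i)
    (hn : n < (Finset.univ.filter fun i => κ i = J).card) (i : Fin d) :
    Tendsto (fun t => curveWeight κ c t i / t ^ J *
        (op lam (curveWeight κ c t) ((Finset.univ.filter fun i => κ i < J).card + n)).eval
          (lam i) ^ 2) (𝓝[Set.Ioo (0 : ℝ) 1] 0)
      (𝓝 (if κ i = J then (blockOp lam κ u J n).eval (lam i) ^ 2 * u i else 0)) := by
  obtain ⟨e, heJ, he⟩ := exists_ip_lowPoly_mul_blockOp hlam hu hu₀ hn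
  set N := (Finset.univ.filter fun i => κ i < J).card + n
  set W := lowPoly lam κ J
  set q := blockOp lam κ u J n with hq
  have hNd : N < d := by
    have hdisj : Disjoint (Finset.univ.filter fun i => κ i < J)
        (Finset.univ.filter fun i => κ i = J) :=
      Finset.disjoint_filter.2 fun i _ h₁ h₂ => h₁.ne h₂
    have := Finset.card_le_univ ((Finset.univ.filter fun i => κ i < J) ∪
      (Finset.univ.filter fun i => κ i = J))
    rw [Finset.card_union_of_disjoint hdisj, Fintype.card_fin] at this
    omega
  have hPm : (W * q).Monic := (lowPoly_monic lam κ J).mul (op_monic n)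
  have hPd : (W * q).natDegree = N := by
    rw [(lowPoly_monic lam κ J).natDegree_mul (q := q) (op_monic n), lowPoly_natDegree, hq, blockOp,
      op_natDegree]
  have hpos : ∀ t ∈ Set.Ioo (0 : ℝ) 1, ∀ i, 0 < curveWeight κ c t i := fun t ht i =>
    mul_pos (pow_pos ht.1 _) (hc i)
  have hbound : ∀ t ∈ Set.Ioo (0 : ℝ) 1, ∀ i, curveWeight κ c t i / t ^ J *
      (W * q - op lam (curveWeight κ c t) N).eval (lam i) ^ 2 ≤
      ∑ k, if κ k = J then 0 else t ^ (2 * max J (κ k) - κ k - J) * (e k ^ 2 / c k) := by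
    intro t ht i
    set w := curveWeight κ c t
    set g := W * q - op lam w N with hg
    have hw := hpos t ht
    have htJ : 0 < t ^ J := pow_pos ht.1 _
    have hgdeg : g.degree < N := by
      have := degree_sub_lt_left (p := W * q) (q := op lam w N)
        (by rw [op_degree, degree_eq_natDegree hPm.ne_zero, hPd]) hPm.ne_zero
        (by rw [hPm.leadingCoeff, (op_monic N).leadingCoeff])
      rwa [degree_eq_natDegree hPm.ne_zero, hPd] at this
    have hgg : ip lam w g g = ∑ k, e k * t ^ max J (κ k) * g.eval (lam k) := by
      rw [← he t g hgdeg]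
      conv_lhs => rw [hg, ip_sub_right, ← hg]
      rw [ip_op_eq_zero hlam hw N hNd.le g hgdeg, sub_zero]
    have hgsum : ip lam w g g = ∑ k, w k * g.eval (lam k) ^ 2 :=
      Finset.sum_congr rfl fun k _ => by ring
    have hnn : ∀ k ∈ Finset.univ, 0 ≤ w k * g.eval (lam k) ^ 2 := fun k _ =>
      mul_nonneg (hw k).le (sq_nonneg _)
    have hcs : ip lam w g g ^ 2 ≤ (∑ k, (e k * t ^ max J (κ k)) ^ 2 / w k) * ip lam w g g := by
      conv_lhs => rw [hgg]
      rw [hgsum]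
      refine Finset.sum_sq_le_sum_mul_sum_of_sq_le_mul _
        (fun k _ => div_nonneg (sq_nonneg _) (hw k).le) hnn fun k _ => ?_
      have : w k ≠ 0 := (hw k).ne'
      refine le_of_eq ?_
      field_simp
    have hle : ip lam w g g ≤ ∑ k, (e k * t ^ max J (κ k)) ^ 2 / w k := by
      have h0 : 0 ≤ ip lam w g g := hgsum ▸ Finset.sum_nonneg hnn
      rcases h0.eq_or_lt with h | h
      · rw [← h]
        exact Finset.sum_nonneg fun k _ => div_nonneg (sq_nonneg _) (hw k).le
      · rw [sq] at hcs
        exact le_of_mul_le_mul_right hcs h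
    have hone : w i * g.eval (lam i) ^ 2 ≤ ip lam w g g :=
      hgsum ▸ Finset.single_le_sum hnn (Finset.mem_univ i)
    calc w i / t ^ J * g.eval (lam i) ^ 2 = w i * g.eval (lam i) ^ 2 / t ^ J := by ring
      _ ≤ (∑ k, (e k * t ^ max J (κ k)) ^ 2 / w k) / t ^ J := by
          gcongr
          exact hone.trans hle
      _ = _ := by
          rw [Finset.sum_div]
          refine Finset.sum_congr rfl fun k _ => ?_
          split_ifs with hk
          · simp [heJ k hk]
          · have hexp : t ^ max J (κ k) * t ^ max J (κ k) =
                t ^ (2 * max J (κ k) - κ k - J) * (t ^ κ k * t ^ J) := by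
              rw [← pow_add, ← pow_add, ← pow_add]
              congr 1
              omega
            have ht0 := ht.1.ne'
            have hck := (hc k).ne'
            rw [div_div, div_eq_iff (mul_pos (hw k) htJ).ne', mul_pow, sq (t ^ _), hexp]
            simp only [curveWeight]
            field_simp
  have hmem : ∀ᶠ t in 𝓝[Set.Ioo (0 : ℝ) 1] 0, t ∈ Set.Ioo (0 : ℝ) 1 := self_mem_nhdsWithin
  have hgzero : Tendsto (fun t => curveWeight κ c t i / t ^ J *
      (W * q - op lam (curveWeight κ c t) N).eval (lam i) ^ 2) (𝓝[Set.Ioo (0 : ℝ) 1] 0)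
      (𝓝 0) := by
    refine tendsto_of_tendsto_of_tendsto_of_le_of_le' tendsto_const_nhds ?_
      (hmem.mono fun t ht => mul_nonneg (div_nonneg (hpos t ht i).le (pow_pos ht.1 _).le)
        (sq_nonneg _)) (hmem.mono fun t ht => hbound t ht i)
    rw [show 𝓝 (0 : ℝ) = 𝓝 (∑ _k : Fin d, 0) by rw [Finset.sum_const_zero]]
    refine tendsto_finsetSum _ fun k _ => ?_
    split_ifs with hk
    · exact tendsto_const_nhds
    · simpa using (tendsto_pow_nhdsWithin_zero (k := 2 * max J (κ k) - κ k - J)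
        (by omega)).mul_const (e k ^ 2 / c k)
  have hPlim : Tendsto (fun t => curveWeight κ c t i / t ^ J * (W * q).eval (lam i) ^ 2)
      (𝓝[Set.Ioo (0 : ℝ) 1] 0) (𝓝 (if κ i = J then q.eval (lam i) ^ 2 * u i else 0)) := by
    rcases lt_trichotomy (κ i) J with h | h | h
    · have : W.eval (lam i) = 0 := lowPoly_eval_eq_zero lam κ J h
      simp [this, h.ne]
    · rw [if_pos h]
      refine tendsto_const_nhds.congr' (hmem.mono fun t ht => ?_)
      have := (pow_pos ht.1 J).ne'
      simp only [hu i h, curveWeight, h, eval_mul]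
      field_simp
    · rw [if_neg h.ne']
      have := (tendsto_pow_nhdsWithin_zero (k := κ i - J) (by omega)).mul_const
        (c i * (W * q).eval (lam i) ^ 2)
      rw [zero_mul] at this
      refine this.congr' (hmem.mono fun t ht => ?_)
      have h0 := (pow_pos ht.1 J).ne'
      have : t ^ κ i = t ^ (κ i - J) * t ^ J := by rw [← pow_add]; congr 1; omega
      simp only [curveWeight, this]
      field_simp
  exact (tendsto_mul_sub_sq hPlim hgzero).congr fun t => by simp

lemma tendsto_sum_op (hlam : Function.Injective lam) (hc : ∀ i, 0 < c i)
    (hu : ∀ i, κ i = J → u i = c i * (lowPoly lam κ J).eval (lam i) ^ 2)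
    (hu₀ : ∀ i, κ i = J → 0 < u i)
    (hn : n < (Finset.univ.filter fun i => κ i = J).card) (f : ℝ[X]) :
    Tendsto (fun t => ip lam (curveWeight κ c t)
        (op lam (curveWeight κ c t) ((Finset.univ.filter fun i => κ i < J).card + n))
        (f * op lam (curveWeight κ c t) ((Finset.univ.filter fun i => κ i < J).card + n)) / t ^ J)
      (𝓝[Set.Ioo (0 : ℝ) 1] 0)
      (𝓝 (ip (restr {i | κ i = J} lam) (restr {i | κ i = J} u)
        (blockOp lam κ u J n) (f * blockOp lam κ u J n))) := by
  rw [ip_restr, Finset.sum_filter]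
  simp only [ip, Finset.sum_div]
  refine tendsto_finsetSum _ fun i _ => ?_
  have := (tendsto_curveWeight_mul_op_sq hlam hc hu hu₀ hn i).const_mul (f.eval (lam i))
  convert this using 2
  · rw [eval_mul]; ring
  · split_ifs
    · rw [eval_mul]; ring
    · simp

end MomentCurve

lemma Jmat_comm {m : ℕ} (μ v : Fin m → ℝ) (i j : Fin m) : Jmat μ v i j = Jmat μ v j i := by
  simp only [Jmat, Matrix.of_apply]
  by_cases h : i = j
  · subst h; rfl
  · simp only [if_neg h, if_neg (Ne.symm h), add_comm (i : ℕ) j, or_comm]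

lemma blockDiag_comm {d r : ℕ} (lam : Fin d → ℝ) (S : Fin r → Finset (Fin d))
    (v : Fin r → Fin d → ℝ) (p q : Fin d) : blockDiag lam S v p q = blockDiag lam S v q p := by
  simp only [blockDiag, Matrix.of_apply]
  refine Finset.sum_congr rfl fun j _ => ?_
  by_cases h : offS S j ≤ (p : ℕ) ∧ (p : ℕ) < offS S j + (S j).card ∧
      offS S j ≤ (q : ℕ) ∧ (q : ℕ) < offS S j + (S j).card
  · rw [dif_pos h, dif_pos ⟨h.2.2.1, h.2.2.2, h.1, h.2.1⟩, Jmat_comm]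
  · rw [dif_neg h, dif_neg fun h' => h ⟨h'.2.2.1, h'.2.2.2, h'.1, h'.2.1⟩]

section Offsets

variable {d r : ℕ} {S : Fin r → Finset (Fin d)}

lemma offS_add_card_le {j k : Fin r} (h : j < k) : offS S j + (S j).card ≤ offS S k := by
  have hj : j ∉ Finset.univ.filter (· < j) := by simp
  rw [offS, add_comm, ← Finset.sum_insert (f := fun k => (S k).card) hj]
  refine Finset.sum_le_sum_of_subset fun i hi => ?_
  simp only [Finset.mem_insert, Finset.mem_filter, Finset.mem_univ, true_and] at hi ⊢
  rcases hi with rfl | hi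
  · exact h
  · exact hi.trans h

lemma OrdPart.sum_card (hS : OrdPart S) : ∑ j, (S j).card = d := by
  rw [← Finset.card_biUnion fun j _ k _ h => hS.2.1 j k h, hS.2.2, Finset.card_univ,
    Fintype.card_fin]

lemma OrdPart.exists_block (hS : OrdPart S) (p : Fin d) :
    ∃ j, offS S j ≤ (p : ℕ) ∧ (p : ℕ) < offS S j + (S j).card := by
  have hex : ∃ k : ℕ, (p : ℕ) < ∑ j ∈ Finset.univ.filter (fun j : Fin r => (j : ℕ) < k),
      (S j).card := by
    refine ⟨r, ?_⟩
    simp [hS.sum_card]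
  have hspec := Nat.find_spec hex
  have hle : Nat.find hex ≤ r := Nat.find_min' hex (by simp [hS.sum_card])
  have hne : Nat.find hex ≠ 0 := fun h => by simp [h] at hspec
  obtain ⟨k, hk⟩ := Nat.exists_eq_succ_of_ne_zero hne
  have hmin := Nat.find_min hex (m := k) (by omega)
  rw [hk] at hspec
  refine ⟨⟨k, by omega⟩, not_lt.1 hmin, hspec.trans_le ?_⟩
  have hj : (⟨k, by omega⟩ : Fin r) ∉ Finset.univ.filter (· < (⟨k, by omega⟩ : Fin r)) := by simp
  rw [offS, add_comm, ← Finset.sum_insert (f := fun k => (S k).card) hj]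
  refine Finset.sum_le_sum_of_subset fun i hi => ?_
  simp only [Finset.mem_insert, Finset.mem_filter, Finset.mem_univ, true_and, Fin.lt_def,
    Fin.ext_iff] at hi ⊢
  omega

lemma block_unique {j k : Fin r} {p : ℕ} (hj : offS S j ≤ p ∧ p < offS S j + (S j).card)
    (hk : offS S k ≤ p ∧ p < offS S k + (S k).card) : j = k := by
  rcases lt_trichotomy j k with h | h | h
  · have := offS_add_card_le (S := S) h; omega
  · exact h
  · have := offS_add_card_le (S := S) h; omega

lemma blockDiag_eq_of_mem (lam : Fin d → ℝ) (v : Fin r → Fin d → ℝ) {j : Fin r} {p q : Fin d}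
    (hp : offS S j ≤ (p : ℕ) ∧ (p : ℕ) < offS S j + (S j).card)
    (hq : offS S j ≤ (q : ℕ) ∧ (q : ℕ) < offS S j + (S j).card) :
    blockDiag lam S v p q = Jmat (restr (S j) lam) (restr (S j) (v j))
      ⟨(p : ℕ) - offS S j, by omega⟩ ⟨(q : ℕ) - offS S j, by omega⟩ := by
  rw [blockDiag, Matrix.of_apply, Finset.sum_eq_single j]
  · rw [dif_pos ⟨hp.1, hp.2, hq⟩]
  · intro k _ hk
    rw [dif_neg fun h => hk (block_unique ⟨h.1, h.2.1⟩ hp)]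
  · simp

lemma blockDiag_eq_zero (lam : Fin d → ℝ) (v : Fin r → Fin d → ℝ) {j k : Fin r} {p q : Fin d}
    (hp : offS S j ≤ (p : ℕ) ∧ (p : ℕ) < offS S j + (S j).card)
    (hq : offS S k ≤ (q : ℕ) ∧ (q : ℕ) < offS S k + (S k).card) (hjk : j ≠ k) :
    blockDiag lam S v p q = 0 := by
  rw [blockDiag, Matrix.of_apply]
  refine Finset.sum_eq_zero fun l _ => dif_neg fun h => hjk ?_
  rw [← block_unique ⟨h.1, h.2.1⟩ hp, ← block_unique ⟨h.2.2.1, h.2.2.2⟩ hq]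

end Offsets

lemma fEnt_odd {m : ℕ} (μ v : Fin m → ℝ) (n : ℕ) : fEnt μ v (2 * n + 1) =
    ip μ v (op μ v n) (X * op μ v n) / ip μ v (op μ v n) (op μ v n) := by
  have h₁ : (2 * n + 1) % 2 = 1 := by omega
  have h₂ : (2 * n + 1) / 2 = n := by omega
  rw [fEnt, if_pos h₁, h₂]

lemma fEnt_even {m : ℕ} (μ v : Fin m → ℝ) (n : ℕ) : fEnt μ v (n + (n + 1) + 1) =
    Real.sqrt (ip μ v (op μ v (n + 1)) (op μ v (n + 1)) / ip μ v (op μ v n) (op μ v n)) := by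
  have h₁ : ¬ (n + (n + 1) + 1) % 2 = 1 := by omega
  have h₂ : (n + (n + 1) + 1) / 2 = n + 1 := by omega
  rw [fEnt, if_neg h₁, h₂, Nat.add_sub_cancel]

/-- Proposition 9 / moment curves: limiting behaviour of
`f(λ, w(t))` along a moment curve. -/
theorem stmt18 {d r : ℕ} (hd : 1 ≤ d) (lam : Fin d → ℝ) (hlam : Function.Injective lam)
    (S : Fin r → Finset (Fin d)) (hS : OrdPart S)
    (v : Fin r → Fin d → ℝ) (hv : ∀ j, ∀ i ∈ S j, 0 < v j i)
    (Q : Fin r → Finset (Fin d))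
    (hQ : ∀ j, Q j = (Finset.univ.filter (· < j)).biUnion S)
    (wc : ℝ → Fin d → ℝ)
    (hwc : ∀ t i, wc t i = ∑ j : Fin r,
      if i ∈ S j then t ^ (j : ℕ) * v j i / Cc lam i (Q j) else 0) :
    ∀ p q : Fin d, Tendsto (fun t => Jmat lam (wc t) p q)
      (𝓝[Set.Ioo (0 : ℝ) 1] 0) (𝓝 (blockDiag lam S v p q)) := by
  choose κ hκ using fun i : Fin d => Finset.mem_biUnion.1 (hS.2.2 ▸ Finset.mem_univ i)
  have hmem : ∀ i j, i ∈ S j ↔ κ i = j := fun i j =>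
    ⟨fun h => by_contra fun hne =>
      Finset.disjoint_left.1 (hS.2.1 _ _ hne) (hκ i).2 h, fun h => h ▸ (hκ i).2⟩
  have hSJ : ∀ J : Fin r, S J = Finset.univ.filter fun i => (κ i : ℕ) = J := fun J => by
    ext i; simp [hmem, Fin.ext_iff]
  have hQJ : ∀ J : Fin r, Q J = Finset.univ.filter fun i => (κ i : ℕ) < J := fun J => by
    ext i; simp [hQ, hmem]
  have hoff : ∀ J : Fin r, offS S J = (Finset.univ.filter fun i => (κ i : ℕ) < J).card :=
    fun J => by
      rw [← hQJ, hQ, Finset.card_biUnion fun j _ k _ h => hS.2.1 j k h, offS]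
  have hCc : ∀ i J, κ i = J → 0 < Cc lam i (Q J) := fun i J h =>
    Finset.prod_pos fun k hk => sq_pos_of_ne_zero (sub_ne_zero.2 (hlam.ne (by
      rintro rfl
      rw [hQJ, Finset.mem_filter, h] at hk
      exact lt_irrefl _ hk.2)))
  set c : Fin d → ℝ := fun i => v (κ i) i / Cc lam i (Q (κ i)) with hcdef
  have hc : ∀ i, 0 < c i := fun i => div_pos (hv _ _ (hκ i).2) (hCc i _ rfl)
  have hw : ∀ t, wc t = curveWeight (fun i => (κ i : ℕ)) c t := fun t => by
    ext i
    simp only [hwc, hmem, Finset.sum_ite_eq, Finset.mem_univ, if_true, curveWeight, hcdef,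
      mul_div_assoc]
  have hlim : ∀ (J : Fin r) (n : ℕ), n < (S J).card → ∀ f : ℝ[X],
      Tendsto (fun t => ip lam (wc t) (op lam (wc t) (offS S J + n))
        (f * op lam (wc t) (offS S J + n)) / t ^ (J : ℕ)) (𝓝[Set.Ioo (0 : ℝ) 1] 0)
      (𝓝 (ip (restr (S J) lam) (restr (S J) (v J)) (op (restr (S J) lam) (restr (S J) (v J)) n)
        (f * op (restr (S J) lam) (restr (S J) (v J)) n))) := by
    intro J n hn f
    have h := tendsto_sum_op (κ := fun i => (κ i : ℕ)) (c := c) (u := v J) (J := J) (n := n)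
      hlam hc (fun i hi => ?_) (fun i hi => hv J i ((hmem i J).2 (Fin.ext hi)))
      (by rwa [← hSJ]) f
    · simp only [hw, hoff]
      simp only [blockOp] at h
      rwa [← hSJ] at h
    · obtain rfl : κ i = J := Fin.ext hi
      rw [lowPoly_eval_sq, ← hQJ, hcdef]
      exact (div_mul_cancel₀ _ (hCc i _ rfl).ne').symm
  have hnorm : ∀ (J : Fin r) (n : ℕ), n < (S J).card →
      0 < ip (restr (S J) lam) (restr (S J) (v J)) (op (restr (S J) lam) (restr (S J) (v J)) n)
        (op (restr (S J) lam) (restr (S J) (v J)) n) := fun J n hn =>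
    ip_op_self_pos (restr_injective _ hlam) (restr_pos _ (hv J)) hn
  have hlim₁ : ∀ (J : Fin r) (n : ℕ), n < (S J).card →
      Tendsto (fun t => ip lam (wc t) (op lam (wc t) (offS S J + n))
        (op lam (wc t) (offS S J + n)) / t ^ (J : ℕ)) (𝓝[Set.Ioo (0 : ℝ) 1] 0)
      (𝓝 (ip (restr (S J) lam) (restr (S J) (v J)) (op (restr (S J) lam) (restr (S J) (v J)) n)
        (op (restr (S J) lam) (restr (S J) (v J)) n))) := fun J n hn => by
    simpa only [one_mul] using hlim J n hn 1
  have ht : ∀ᶠ t in 𝓝[Set.Ioo (0 : ℝ) 1] 0, t ≠ 0 := by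
    filter_upwards [self_mem_nhdsWithin] with t ht using ht.1.ne'
  intro p q
  wlog hpq : (p : ℕ) ≤ q generalizing p q
  · simpa only [Jmat_comm _ _ q p, blockDiag_comm _ _ _ q p] using this q p (not_le.1 hpq).le
  obtain ⟨J, hJ⟩ := hS.exists_block p
  obtain ⟨K, hK⟩ := hS.exists_block q
  obtain ⟨n, hn⟩ := Nat.exists_eq_add_of_le hJ.1
  obtain ⟨k, hk⟩ := Nat.exists_eq_add_of_le hK.1
  rcases hpq.eq_or_lt with heq | hlt
  · obtain rfl : p = q := Fin.ext heq
    rw [blockDiag_eq_of_mem lam v hJ hJ]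
    simp only [Jmat, Matrix.of_apply, if_true, hn, Nat.add_sub_cancel_left, fEnt_odd]
    refine ((hlim J n (by omega) X).div (hlim₁ J n (by omega))
      (hnorm J n (by omega)).ne').congr' ?_
    filter_upwards [ht] with t ht
    exact div_div_div_cancel_right₀ (pow_ne_zero _ ht) _ _
  have hne : p ≠ q := fun h => hlt.ne (congrArg _ h)
  rcases (Nat.succ_le_of_lt hlt).eq_or_lt with hsucc | hfar
  · have hsucc' : (q : ℕ) = p + 1 := hsucc.symm
    simp only [Jmat, Matrix.of_apply, if_neg hne, hsucc', true_or, if_true, fEnt_even]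
    by_cases hJK : J = K
    · subst hJK
      have hkn : k = n + 1 := by omega
      rw [blockDiag_eq_of_mem lam v hJ hK]
      have hne' : n ≠ n + 1 := by omega
      simp only [Jmat, Matrix.of_apply, hn, hk, hkn, Nat.add_sub_cancel_left, Fin.mk.injEq,
        if_neg hne', true_or, if_true, fEnt_even]
      refine (((hlim₁ J (n + 1) (by omega)).div (hlim₁ J n (by omega))
        (hnorm J n (by omega)).ne').congr' ?_).sqrt
      filter_upwards [ht] with t ht
      exact div_div_div_cancel_right₀ (pow_ne_zero _ ht) _ _
    · rw [blockDiag_eq_zero lam v hJ hK hJK]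
      have hlt' : (J : ℕ) < K := lt_of_le_of_ne (not_lt.1 fun h => by
        have := offS_add_card_le (S := S) (Fin.lt_def.2 h)
        omega) fun h => hJK (Fin.ext h)
      have h := (tendsto_pow_nhdsWithin_zero (k := (K : ℕ) - J) (by omega)).mul
        ((hlim₁ K k (by omega)).div (hlim₁ J n (by omega)) (hnorm J n (by omega)).ne')
      rw [zero_mul] at h
      rw [show (p : ℕ) + 1 = offS S K + k by omega, hn,
        show 𝓝 (0 : ℝ) = 𝓝 √0 by rw [Real.sqrt_zero]]
      refine (h.congr' ?_).sqrt
      filter_upwards [ht] with t ht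
      have hpow : t ^ (K : ℕ) = t ^ ((K : ℕ) - J) * t ^ (J : ℕ) := by
        rw [← pow_add]; congr 1; omega
      have h₁ : t ^ (J : ℕ) ≠ 0 := pow_ne_zero _ ht
      have h₂ : t ^ ((K : ℕ) - J) ≠ 0 := pow_ne_zero _ ht
      simp only [Pi.div_apply, hpow]
      field_simp
  · have h₁ : ¬ ((p : ℕ) + 1 = q ∨ (q : ℕ) + 1 = p) := by omega
    have h₂ : blockDiag lam S v p q = 0 := by
      by_cases hJK : J = K
      · subst hJK
        rw [blockDiag_eq_of_mem lam v hJ hK, Jmat, Matrix.of_apply, if_neg, if_neg]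
        · simp only; omega
        · rw [Fin.mk.injEq]; omega
      · exact blockDiag_eq_zero lam v hJ hK hJK
    rw [h₂]
    simp only [Jmat, Matrix.of_apply, if_neg hne, if_neg h₁]
    exact tendsto_const_nhds
end
end
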